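/- Let G be a group with a finite symmetric generating set S, and suppose G is finitely presented with respect to S: the kernel N of the canonical surjection FreeGroup S → G is the normal closure of a finite set R of reduced relator words. Assume G is one-ended, i.e. G is infinite and for every n the complement of the ball B_n has exactly one infinite connected component (in the Cayley graph Cay(G,S)). Let r be a natural number with 2r > |w| for every relator w ∈ R, where |w| denotes the word length of w. Then for every n ≥ 0, the set B_{n+r} ∩ B_n^{c,∞} induces a connected subgraph of Cay(G,S), where B_n^{c,∞} denotes the unique infinite connected component of the complement of B_n. -/

import Mathlib

/-- The Cayley graph of a group `G` with respect to a set `S`: `g` and `h` are adjacent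
iff `g⁻¹ * h ∈ S` (for symmetric `S` with `1 ∉ S`, `fromRel` gives exactly this relation). -/
def cayleyGraph {G : Type*} [Group G] (S : Set G) : SimpleGraph G :=
  SimpleGraph.fromRel (fun g h => g⁻¹ * h ∈ S)

/-- The ball of radius `n` centered at the identity, for the word metric
(graph distance in the Cayley graph). -/
def cayleyBall {G : Type*} [Group G] (S : Set G) (n : ℕ) : Set G :=
  {g : G | (cayleyGraph S).dist 1 g ≤ n}

section CayleyGraph

variable {G : Type*} [Group G] {S : Set G}

theorem cayleyGraph_adj_iff (hSsym : ∀ s ∈ S, s⁻¹ ∈ S) (hS1 : (1 : G) ∉ S) {g h : G} :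
    (cayleyGraph S).Adj g h ↔ g⁻¹ * h ∈ S := by
  simp only [cayleyGraph, SimpleGraph.fromRel_adj]
  constructor
  · rintro ⟨-, h1 | h1⟩
    · exact h1
    · simpa using hSsym _ h1
  · intro h1
    refine ⟨?_, Or.inl h1⟩
    rintro rfl
    exact hS1 (by simpa using h1)

theorem cayleyGraph_connected (hSsym : ∀ s ∈ S, s⁻¹ ∈ S) (hS1 : (1 : G) ∉ S)
    (hgen : Subgroup.closure S = ⊤) : (cayleyGraph S).Connected := by
  have key : ∀ x : G, ∀ g : G, (cayleyGraph S).Reachable g (g * x) := by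
    intro x
    have hx : x ∈ Subgroup.closure S := hgen ▸ Subgroup.mem_top x
    induction hx using Subgroup.closure_induction with
    | mem s hs =>
      intro g
      exact SimpleGraph.Adj.reachable ((cayleyGraph_adj_iff hSsym hS1).2 (by simpa using hs))
    | one => intro g; simp
    | mul x y _ _ hx hy =>
      intro g
      rw [← mul_assoc]
      exact (hx g).trans (hy _)
    | inv x _ hx =>
      intro g
      simpa using (hx (g * x⁻¹)).symm
  refine ⟨fun g h => ?_⟩
  simpa using key (g⁻¹ * h) g

end CayleyGraph

theorem SimpleGraph.Connected.exists_adj_dist_eq {V : Type*} {Γ : SimpleGraph V}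
    (hΓ : Γ.Connected) {u v : V} {m : ℕ} (h : Γ.dist u v = m + 1) :
    ∃ w, Γ.Adj w v ∧ Γ.dist u w = m := by
  obtain ⟨p, hp⟩ := hΓ.exists_walk_length_eq_dist v u
  rw [SimpleGraph.dist_comm, h] at hp
  cases p with
  | nil => simp at hp
  | @cons _ w _ hadj q =>
    refine ⟨w, hadj.symm, ?_⟩
    have h1 : Γ.dist w u ≤ q.length := SimpleGraph.dist_le q
    have h2 := hΓ.dist_triangle (u := u) (v := w) (w := v)
    have h3 : Γ.dist w v = 1 := SimpleGraph.dist_eq_one_iff_adj.2 hadj.symm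
    have h4 := SimpleGraph.dist_comm (G := Γ) (u := u) (v := w)
    simp only [SimpleGraph.Walk.length_cons] at hp
    omega

section CocycleAction

variable {G : Type*} [Group G] {S : Set G}

/-- The canonical homomorphism from the free group on `S` to `G`. -/
abbrev freeGroupEval (S : Set G) : FreeGroup S →* G := FreeGroup.lift (Subtype.val : S → G)

/-- The permutation of `G × ℤ` that moves the first coordinate along the edge
from `g` to `g * x⁻¹` and adds to the second one the value of `f` on that edge. -/
def cocyclePerm (f : G → G → ℤ) (hf : ∀ u v, f v u = -f u v) (x : G) : Equiv.Perm (G × ℤ) where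
  toFun p := (p.1 * x⁻¹, p.2 + f p.1 (p.1 * x⁻¹))
  invFun p := (p.1 * x, p.2 + f p.1 (p.1 * x))
  left_inv p := by
    ext
    · simp
    · simp [hf p.1 (p.1 * x⁻¹)]
  right_inv p := by
    ext
    · simp
    · simp [hf p.1 (p.1 * x)]

/-- The action of the free group on `S` on `G × ℤ` that integrates `f` along paths in the
Cayley graph. -/
def cocycleHom (S : Set G) (f : G → G → ℤ) (hf : ∀ u v, f v u = -f u v) :
    FreeGroup S →* Equiv.Perm (G × ℤ) :=
  FreeGroup.lift fun s => cocyclePerm f hf s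

variable {f : G → G → ℤ} {hf : ∀ u v, f v u = -f u v}

theorem cocycleHom_mk_singleton (a : S × Bool) (p : G × ℤ) :
    cocycleHom S f hf (FreeGroup.mk [a]) p =
      (p.1 * (freeGroupEval S (FreeGroup.mk [a]))⁻¹,
        p.2 + f p.1 (p.1 * (freeGroupEval S (FreeGroup.mk [a]))⁻¹)) := by
  obtain ⟨s, b⟩ := a
  cases b
  · simp only [cocycleHom, FreeGroup.lift_mk]
    simp [cocyclePerm, Equiv.Perm.inv_def]
  · simp only [cocycleHom, FreeGroup.lift_mk]
    simp [cocyclePerm]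

theorem FreeGroup.mk_cons {α : Type*} (a : α × Bool) (L : List (α × Bool)) :
    FreeGroup.mk (a :: L) = FreeGroup.mk [a] * FreeGroup.mk L := by
  simp

theorem cocycleHom_mk_fst (L : List (S × Bool)) (p : G × ℤ) :
    (cocycleHom S f hf (FreeGroup.mk L) p).1 =
      p.1 * (freeGroupEval S (FreeGroup.mk L))⁻¹ := by
  induction L with
  | nil => simp [← FreeGroup.one_eq_mk]
  | cons a L ih =>
    rw [FreeGroup.mk_cons, map_mul, Equiv.Perm.mul_apply, cocycleHom_mk_singleton, ih,
      map_mul, mul_inv_rev, mul_assoc]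

theorem cocycleHom_fst (w : FreeGroup S) (p : G × ℤ) :
    (cocycleHom S f hf w p).1 = p.1 * (freeGroupEval S w)⁻¹ := by
  induction w using Quot.inductionOn with
  | _ L => exact cocycleHom_mk_fst L p

theorem adj_freeGroupEval_mk_singleton (hSsym : ∀ s ∈ S, s⁻¹ ∈ S) (hS1 : (1 : G) ∉ S)
    (a : S × Bool) (g : G) :
    (cayleyGraph S).Adj g (g * (freeGroupEval S (FreeGroup.mk [a]))⁻¹) := by
  rw [cayleyGraph_adj_iff hSsym hS1]
  obtain ⟨⟨s, hs⟩, b⟩ := a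
  cases b
  · simpa using hs
  · simpa using hSsym s hs

theorem dist_freeGroupEval_mk_le (hSsym : ∀ s ∈ S, s⁻¹ ∈ S) (hS1 : (1 : G) ∉ S)
    (hgen : Subgroup.closure S = ⊤) (L : List (S × Bool)) (g : G) :
    (cayleyGraph S).dist g (g * (freeGroupEval S (FreeGroup.mk L))⁻¹) ≤ L.length := by
  induction L with
  | nil => simp [← FreeGroup.one_eq_mk]
  | cons a L ih =>
    have hadj := adj_freeGroupEval_mk_singleton hSsym hS1 a
      (g * (freeGroupEval S (FreeGroup.mk L))⁻¹)
    rw [mul_assoc, ← mul_inv_rev, ← map_mul, ← FreeGroup.mk_cons] at hadj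
    have h1 := SimpleGraph.dist_eq_one_iff_adj.2 hadj
    have h2 := (cayleyGraph_connected hSsym hS1 hgen).dist_triangle (u := g)
      (v := g * (freeGroupEval S (FreeGroup.mk L))⁻¹)
      (w := g * (freeGroupEval S (FreeGroup.mk (a :: L)))⁻¹)
    rw [List.length_cons]
    omega

/-- If `f` is the coboundary of `ψ` on `U`, then integrating `f` along a path in `U` gives the
difference of the values of `ψ` at its endpoints. -/
theorem cocycleHom_mk_snd_of_coboundary (hSsym : ∀ s ∈ S, s⁻¹ ∈ S) (hS1 : (1 : G) ∉ S)
    (U : Set G) (ψ : G → ℤ)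
    (hψ : ∀ u ∈ U, ∀ v ∈ U, (cayleyGraph S).Adj u v → f u v = ψ v - ψ u)
    (p : G × ℤ) (L : List (S × Bool))
    (hU : ∀ L₂, L₂ <:+ L → p.1 * (freeGroupEval S (FreeGroup.mk L₂))⁻¹ ∈ U) :
    (cocycleHom S f hf (FreeGroup.mk L) p).2 =
      p.2 + (ψ (p.1 * (freeGroupEval S (FreeGroup.mk L))⁻¹) - ψ p.1) := by
  induction L with
  | nil => simp [← FreeGroup.one_eq_mk]
  | cons a L ih =>
    have hadj := adj_freeGroupEval_mk_singleton hSsym hS1 a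
      (p.1 * (freeGroupEval S (FreeGroup.mk L))⁻¹)
    have hL := hU L (List.suffix_cons a L)
    have haL := hU (a :: L) List.suffix_rfl
    have ih' := ih fun L₂ h => hU L₂ (h.trans (List.suffix_cons a L))
    rw [FreeGroup.mk_cons, map_mul (freeGroupEval S), mul_inv_rev, ← mul_assoc] at haL ⊢
    rw [map_mul, Equiv.Perm.mul_apply, cocycleHom_mk_singleton, ih', cocycleHom_mk_fst,
      hψ _ hL _ haL hadj]
    ring

/-- An antisymmetric edge function which is a coboundary on the ball of radius `n + r` and
vanishes outside the ball of radius `n` integrates to zero along loops of length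
less than `2 * r`. -/
theorem cocycleHom_mk_eq_self_of_length_lt (hSsym : ∀ s ∈ S, s⁻¹ ∈ S) (hS1 : (1 : G) ∉ S)
    (hgen : Subgroup.closure S = ⊤) {n r : ℕ} (φ : G → ℤ)
    (hin : ∀ u ∈ cayleyBall S (n + r), ∀ v ∈ cayleyBall S (n + r),
      (cayleyGraph S).Adj u v → f u v = φ v - φ u)
    (hout : ∀ u ∉ cayleyBall S n, ∀ v ∉ cayleyBall S n, f u v = 0)
    (L : List (S × Bool)) (hlen : L.length < 2 * r)
    (hL : freeGroupEval S (FreeGroup.mk L) = 1) (p : G × ℤ) :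
    cocycleHom S f hf (FreeGroup.mk L) p = p := by
  have hconn := cayleyGraph_connected hSsym hS1 hgen
  have hbase : ∀ M : List (S × Bool), M.length < 2 * r →
      freeGroupEval S (FreeGroup.mk M) = 1 → ∀ q : G × ℤ, q.1 ∈ cayleyBall S n →
      cocycleHom S f hf (FreeGroup.mk M) q = q := by
    intro M hMlen hM q hq
    have hsnd := cocycleHom_mk_snd_of_coboundary (hf := hf) hSsym hS1 _ φ hin q M (by
      rintro M₂ ⟨M₁, rfl⟩
      rw [← FreeGroup.mul_mk, map_mul] at hM
      have h1 := dist_freeGroupEval_mk_le hSsym hS1 hgen M₂ q.1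
      have h2 := dist_freeGroupEval_mk_le hSsym hS1 hgen M₁
        (q.1 * (freeGroupEval S (FreeGroup.mk M₂))⁻¹)
      rw [mul_assoc, ← mul_inv_rev, hM, inv_one, mul_one, SimpleGraph.dist_comm] at h2
      have h3 := hconn.dist_triangle (u := 1) (v := q.1)
        (w := q.1 * (freeGroupEval S (FreeGroup.mk M₂))⁻¹)
      simp only [cayleyBall, Set.mem_ofPred_eq] at hq ⊢
      rw [List.length_append] at hMlen
      omega)
    ext
    · rw [cocycleHom_fst, hM]; simp
    · rw [hsnd, hM]; simp
  by_cases hmeet : ∃ L₂, L₂ <:+ L ∧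
      p.1 * (freeGroupEval S (FreeGroup.mk L₂))⁻¹ ∈ cayleyBall S n
  · obtain ⟨L₂, ⟨L₁, rfl⟩, hmem⟩ := hmeet
    have hrot := hbase (L₂ ++ L₁)
      (by rw [List.length_append] at hlen ⊢; omega)
      (by rw [← FreeGroup.mul_mk, map_mul] at hL ⊢; exact mul_eq_one_comm.1 hL)
      (cocycleHom S f hf (FreeGroup.mk L₂) p)
      (by rw [cocycleHom_mk_fst]; exact hmem)
    rw [← FreeGroup.mul_mk, map_mul, Equiv.Perm.mul_apply] at hrot ⊢
    exact (cocycleHom S f hf (FreeGroup.mk L₂)).injective hrot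
  · push Not at hmeet
    have hsnd := cocycleHom_mk_snd_of_coboundary (hf := hf) hSsym hS1 (cayleyBall S n)ᶜ
      (fun _ => 0) (fun u hu v hv _ => by simpa using hout u hu v hv) p L hmeet
    ext
    · rw [cocycleHom_fst, hL]; simp
    · rw [hsnd]; simp

end CocycleAction

/-- A group that is not trivial has no presentation without relators over a
symmetric generating set. -/
theorem ker_freeGroupEval_ne_bot {G : Type*} [Group G] [Nontrivial G] {S : Set G}
    (hSsym : ∀ s ∈ S, s⁻¹ ∈ S) (hgen : Subgroup.closure S = ⊤) :
    (freeGroupEval S).ker ≠ ⊥ := by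
  intro hbot
  obtain ⟨s, hs⟩ : S.Nonempty := by
    rw [Set.nonempty_iff_ne_empty]
    rintro rfl
    rw [Subgroup.closure_empty] at hgen
    exact bot_ne_top hgen
  have hmem : FreeGroup.of (⟨s, hs⟩ : S) * FreeGroup.of ⟨s⁻¹, hSsym s hs⟩ ∈
      (freeGroupEval S).ker := by
    simp [MonoidHom.mem_ker]
  rw [hbot, Subgroup.mem_bot] at hmem
  have := congrArg (FreeGroup.lift fun _ : S => Multiplicative.ofAdd (1 : ℤ)) hmem
  rw [map_mul, FreeGroup.lift_apply_of, FreeGroup.lift_apply_of, MonoidHom.map_one, ← ofAdd_add]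
    at this
  exact absurd (Multiplicative.ofAdd.injective this) (by decide)

/-- **Connected spheres** (Theorem 1 of the paper). Let `G` be a one-ended group with a
finite symmetric generating set `S`, finitely presented with respect to `S`: the kernel of
`FreeGroup S → G` is the normal closure of a finite set `R` of (reduced) relators. If
`2 * r > |w|` for every `w ∈ R`, then for every `n`, the intersection of the ball
`B_{n+r}` with the (unique) infinite connected component `B_n^{c,∞}` of the complement of
`B_n` induces a connected subgraph of the Cayley graph. The infinite component is
represented by the image in `G` of the vertex set `C.supp` of any infinite connected
component `C` of the subgraph induced on `(B_n)ᶜ`. -/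
theorem connected_spheres_of_finitelyPresented
    {G : Type*} [Group G] [DecidableEq G] (S : Set G)
    (hSfin : S.Finite) (hSsym : ∀ s ∈ S, s⁻¹ ∈ S) (hS1 : (1 : G) ∉ S)
    (hgen : Subgroup.closure S = ⊤)
    (R : Set (FreeGroup S)) (hRfin : R.Finite)
    (hpres : ((FreeGroup.lift (Subtype.val : S → G)).ker : Subgroup (FreeGroup S)) =
      Subgroup.normalClosure R)
    (hGinf : Infinite G)
    (honeEnd : ∀ n : ℕ,
      ∃! C : ((cayleyGraph S).induce (cayleyBall S n)ᶜ).ConnectedComponent,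
        C.supp.Infinite)
    (r : ℕ) (hr : ∀ w ∈ R, (FreeGroup.toWord w).length < 2 * r)
    (n : ℕ)
    (C : ((cayleyGraph S).induce (cayleyBall S n)ᶜ).ConnectedComponent)
    (hC : C.supp.Infinite) :
    ((cayleyGraph S).induce
      (cayleyBall S (n + r) ∩ (Subtype.val '' C.supp))).Connected := by
  classical
  have hconn := cayleyGraph_connected hSsym hS1 hgen
  have hCstep : ∀ x y : G, x ∈ Subtype.val '' C.supp → y ∉ cayleyBall S n →
      (cayleyGraph S).Adj x y → y ∈ Subtype.val '' C.supp := by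
    rintro _ y ⟨x, hx, rfl⟩ hy hadj
    refine ⟨⟨y, hy⟩, ?_, rfl⟩
    exact C.mem_supp_of_adj_mem_supp hx (SimpleGraph.induce_adj.2 hadj)
  have hCout : ∀ x ∈ Subtype.val '' C.supp, x ∉ cayleyBall S n := by
    rintro _ ⟨x, -, rfl⟩
    exact x.2
  have hmem : ∀ m x, x ∈ cayleyBall S m ↔ (cayleyGraph S).dist 1 x ≤ m := fun _ _ => Iff.rfl
  have hr0 : 0 < r := by
    by_contra h
    have hR : R = ∅ := Set.eq_empty_of_forall_notMem fun w hw => by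
      have := hr w hw
      omega
    rw [hR, Subgroup.normalClosure_empty] at hpres
    exact ker_freeGroupEval_ne_bot hSsym hgen hpres
  have hdescend : ∀ k x, x ∈ Subtype.val '' C.supp → (cayleyGraph S).dist 1 x = n + 1 + k →
      ∃ y ∈ Subtype.val '' C.supp, (cayleyGraph S).dist 1 y = n + 1 ∧
        ∀ (hx : x ∈ cayleyBall S (n + r) ∩ Subtype.val '' C.supp)
          (hy : y ∈ cayleyBall S (n + r) ∩ Subtype.val '' C.supp),
          ((cayleyGraph S).induce
            (cayleyBall S (n + r) ∩ Subtype.val '' C.supp)).Reachable ⟨x, hx⟩ ⟨y, hy⟩ := by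
    intro k
    induction k with
    | zero => exact fun x hx hd => ⟨x, hx, hd, fun _ _ => SimpleGraph.Reachable.refl _⟩
    | succ k ih =>
      intro x hx hd
      obtain ⟨z, hadj, hz⟩ := hconn.exists_adj_dist_eq (m := n + 1 + k) hd
      have hzC := hCstep x z hx (by rw [hmem]; omega) hadj.symm
      obtain ⟨y, hyC, hy, hreach⟩ := ih z hzC hz
      refine ⟨y, hyC, hy, fun hxX hyX => ?_⟩
      have hzX : z ∈ cayleyBall S (n + r) ∩ Subtype.val '' C.supp := by
        refine ⟨?_, hzC⟩
        have := hxX.1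
        rw [hmem] at this ⊢
        omega
      exact (SimpleGraph.Adj.reachable (SimpleGraph.induce_adj.2 hadj.symm)).trans
        (hreach hzX hyX)
  have hbottom : ∀ x ∈ Subtype.val '' C.supp, ∃ k, (cayleyGraph S).dist 1 x = n + 1 + k := by
    intro x hx
    have := hCout x hx
    rw [hmem] at this
    exact ⟨(cayleyGraph S).dist 1 x - (n + 1), by omega⟩
  have hsphere : ∀ y ∈ Subtype.val '' C.supp, (cayleyGraph S).dist 1 y = n + 1 →
      y ∈ cayleyBall S (n + r) ∩ Subtype.val '' C.supp :=
    fun y hy hd => ⟨by rw [hmem]; omega, hy⟩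
  have hne : Nonempty ↥(cayleyBall S (n + r) ∩ Subtype.val '' C.supp) := by
    obtain ⟨x, hx⟩ := hC.nonempty
    obtain ⟨k, hk⟩ := hbottom x ⟨x, hx, rfl⟩
    obtain ⟨y, hyC, hy, -⟩ := hdescend k x ⟨x, hx, rfl⟩ hk
    exact ⟨⟨y, hsphere y hyC hy⟩⟩
  have hmain : ∀ (a b : G) (ha : a ∈ cayleyBall S (n + r) ∩ Subtype.val '' C.supp)
      (hb : b ∈ cayleyBall S (n + r) ∩ Subtype.val '' C.supp),
      (cayleyGraph S).dist 1 a = n + 1 → (cayleyGraph S).dist 1 b = n + 1 →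
      ((cayleyGraph S).induce
        (cayleyBall S (n + r) ∩ Subtype.val '' C.supp)).Reachable ⟨a, ha⟩ ⟨b, hb⟩ := by
    intro a b ha hb had hbd
    by_contra hnot
    let Y : Set G := {y | ∃ hy : y ∈ cayleyBall S (n + r) ∩ Subtype.val '' C.supp,
      ((cayleyGraph S).induce
        (cayleyBall S (n + r) ∩ Subtype.val '' C.supp)).Reachable ⟨a, ha⟩ ⟨y, hy⟩}
    have haY : a ∈ Y := ⟨ha, SimpleGraph.Reachable.refl _⟩
    have hbY : b ∉ Y := fun ⟨_, h⟩ => hnot h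
    have hYout : ∀ y ∈ cayleyBall S n, y ∉ Y := fun y hy ⟨hyX, _⟩ => hCout y hyX.2 hy
    have hYstep : ∀ u ∈ Y, ∀ v ∈ cayleyBall S (n + r), v ∉ cayleyBall S n →
        (cayleyGraph S).Adj u v → v ∈ Y := by
      rintro u ⟨huX, hu⟩ v hv hvn hadj
      have hvX : v ∈ cayleyBall S (n + r) ∩ Subtype.val '' C.supp :=
        ⟨hv, hCstep u v huX.2 hvn hadj⟩
      exact ⟨hvX, hu.trans (SimpleGraph.Adj.reachable (SimpleGraph.induce_adj.2 hadj))⟩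
    let φ : G → ℤ := fun g => if g ∈ Y then 1 else 0
    let f : G → G → ℤ := fun u v =>
      if u ∈ cayleyBall S n ∨ v ∈ cayleyBall S n then φ v - φ u else 0
    have hf : ∀ u v, f v u = -f u v := by
      intro u v
      simp only [f, or_comm (a := v ∈ cayleyBall S n)]
      split_ifs <;> simp
    have hout : ∀ u ∉ cayleyBall S n, ∀ v ∉ cayleyBall S n, f u v = 0 :=
      fun u hu v hv => if_neg (by tauto)
    have hin : ∀ u ∈ cayleyBall S (n + r), ∀ v ∈ cayleyBall S (n + r),
        (cayleyGraph S).Adj u v → f u v = φ v - φ u := by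
      intro u hu v hv hadj
      by_cases h : u ∈ cayleyBall S n ∨ v ∈ cayleyBall S n
      · exact if_pos h
      · have hiff : u ∈ Y ↔ v ∈ Y :=
          ⟨fun h' => hYstep u h' v hv (by tauto) hadj,
            fun h' => hYstep v h' u hu (by tauto) hadj.symm⟩
        push Not at h
        rw [hout u h.1 v h.2]
        simp [φ, hiff]
    have hker : ∀ w ∈ (freeGroupEval S).ker, cocycleHom S f hf w = 1 := by
      have hle : (freeGroupEval S).ker ≤ (cocycleHom S f hf).ker := by
        rw [hpres]
        refine Subgroup.normalClosure_le_normal fun w hw => ?_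
        have hw1 : w ∈ (freeGroupEval S).ker := by
          rw [hpres]
          exact Subgroup.subset_normalClosure hw
        have hwL := FreeGroup.mk_toWord (x := w)
        rw [SetLike.mem_coe, MonoidHom.mem_ker]
        ext1 p
        rw [← hwL]
        exact cocycleHom_mk_eq_self_of_length_lt hSsym hS1 hgen φ hin hout _ (hr w hw)
          (by rw [hwL]; exact hw1) p
      exact fun w hw => hle hw
    let T : Set (G × ℤ) := {p | ∃ w, cocycleHom S f hf w (1, 0) = p}
    have hTuniq : ∀ x c d, (x, c) ∈ T → (x, d) ∈ T → c = d := by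
      rintro x c d ⟨w, hw⟩ ⟨w', hw'⟩
      have h1 := cocycleHom_fst (f := f) (hf := hf) w (1, 0)
      have h2 := cocycleHom_fst (f := f) (hf := hf) w' (1, 0)
      rw [hw, one_mul] at h1
      rw [hw', one_mul] at h2
      have heq : freeGroupEval S w = freeGroupEval S w' := inv_injective (h1.symm.trans h2)
      have h3 := hker (w⁻¹ * w') (by rw [MonoidHom.mem_ker, map_mul, map_inv, heq]; simp)
      rw [map_mul, map_inv, inv_mul_eq_one] at h3
      rw [h3, hw'] at hw
      exact (congrArg Prod.snd hw).symm
    have hTstep : ∀ x c y, (x, c) ∈ T → (cayleyGraph S).Adj x y → (y, c + f x y) ∈ T := by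
      rintro x c y ⟨w, hw⟩ hadj
      have hs := hSsym _ ((cayleyGraph_adj_iff hSsym hS1).1 hadj)
      refine ⟨FreeGroup.of ⟨_, hs⟩ * w, ?_⟩
      rw [map_mul, Equiv.Perm.mul_apply, hw]
      simp [cocycleHom, cocyclePerm]
    have hTball : ∀ m x, (cayleyGraph S).dist 1 x = m → m ≤ n → (x, 0) ∈ T := by
      intro m
      induction m with
      | zero =>
        intro x hx _
        rw [hconn.dist_eq_zero_iff] at hx
        exact ⟨1, by rw [map_one, Equiv.Perm.one_apply, hx]⟩
      | succ m ih =>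
        intro x hx hmn
        obtain ⟨z, hadj, hz⟩ := hconn.exists_adj_dist_eq hx
        have hxn : x ∈ cayleyBall S n := by rw [hmem]; omega
        have hzn : z ∈ cayleyBall S n := by rw [hmem]; omega
        have := hTstep z 0 x (ih z hz (by omega)) hadj
        simpa [f, φ, hxn, hYout x hxn, hYout z hzn] using this
    have hTsphere : ∀ x, (cayleyGraph S).dist 1 x = n + 1 → (x, φ x) ∈ T := by
      intro x hx
      obtain ⟨z, hadj, hz⟩ := hconn.exists_adj_dist_eq hx
      have hzn : z ∈ cayleyBall S n := by rw [hmem]; omega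
      have := hTstep z 0 x (hTball n z hz le_rfl) hadj
      simpa [f, φ, hzn, hYout z hzn] using this
    have hTC : ∀ (c : ℤ) (u v : ↥(cayleyBall S n)ᶜ),
        ((cayleyGraph S).induce (cayleyBall S n)ᶜ).Walk u v →
        ((u : G), c) ∈ T → ((v : G), c) ∈ T := by
      intro c u v p
      induction p with
      | nil => exact id
      | @cons u v _ hadj _ ih =>
        intro hu
        have := hTstep u c v hu (SimpleGraph.induce_adj.1 hadj)
        rw [hout u u.2 v v.2, add_zero] at this
        exact ih this
    obtain ⟨a', ha'C, rfl⟩ := ha.2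
    obtain ⟨b', hb'C, rfl⟩ := hb.2
    obtain ⟨p⟩ := C.reachable_of_mem_supp ha'C hb'C
    have h1 := hTC _ _ _ p (hTsphere _ had)
    have h2 := hTuniq _ _ _ h1 (hTsphere _ hbd)
    simp [φ, haY, hbY] at h2
  refine ⟨?_⟩
  rintro ⟨x, hx⟩ ⟨y, hy⟩
  obtain ⟨k, hk⟩ := hbottom x hx.2
  obtain ⟨l, hl⟩ := hbottom y hy.2
  obtain ⟨a, haC, ha, hxa⟩ := hdescend k x hx.2 hk
  obtain ⟨b, hbC, hb, hyb⟩ := hdescend l y hy.2 hl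
  exact (hxa hx (hsphere a haC ha)).trans
    ((hmain a b (hsphere a haC ha) (hsphere b hbC hb) ha hb).trans
      (hyb hy (hsphere b hbC hb)).symm)
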